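/- For z > ℓ+1 (with ℓ ≥ 1 an integer), the equation z = T·Q(T,ℓ)/Q(T,ℓ+1) has a unique solution T = T_z in (0,∞). -/

import Mathlib

/-- Tail probability `P(Po(x) ≥ y)` of a Poisson random variable with parameter `x`. -/
noncomputable def Q (x : ℝ) (y : ℕ) : ℝ :=
  1 - Real.exp (-x) * ∑ j ∈ Finset.range y, x ^ j / (Nat.factorial j)

lemma Q_hasSum (x : ℝ) (n : ℕ) :
    HasSum (fun k : ℕ => x ^ (k + n) / ((k + n).factorial : ℝ)) (Real.exp x * Q x n) := by
  have h : HasSum (fun k : ℕ => x ^ k / (k.factorial : ℝ)) (Real.exp x) := by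
    rw [Real.exp_eq_exp_ℝ]
    exact NormedSpace.expSeries_div_hasSum_exp x
  have h2 := (hasSum_nat_add_iff' n).2 h
  convert h2 using 1
  · rfl
  unfold Q
  have : Real.exp x * Real.exp (-x) = 1 := by rw [← Real.exp_add]; simp
  rw [mul_sub, ← mul_assoc, this]; ring

lemma Q_lower (x : ℝ) (hx : 0 < x) (n : ℕ) :
    x ^ n / (n.factorial : ℝ) ≤ Real.exp x * Q x n := by
  have := le_hasSum (Q_hasSum x n) 0 (fun k _ => by positivity)
  simpa using this

lemma Q_pos (x : ℝ) (hx : 0 < x) (n : ℕ) : 0 < Q x n := by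
  have h := Q_lower x hx n
  have h1 : 0 < x ^ n / (n.factorial : ℝ) := by positivity
  exact pos_of_mul_pos_right (h1.trans_le h) (Real.exp_pos x).le

lemma Q_upper (x : ℝ) (hx : 0 < x) (n : ℕ) :
    Real.exp x * Q x n ≤ x ^ n / (n.factorial : ℝ) * Real.exp x := by
  have h : HasSum (fun k : ℕ => x ^ k / (k.factorial : ℝ)) (Real.exp x) := by
    rw [Real.exp_eq_exp_ℝ]
    exact NormedSpace.expSeries_div_hasSum_exp x
  refine hasSum_le (fun k => ?_) (Q_hasSum x n) (h.mul_left _)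
  have h3 : ((n.factorial : ℝ) * k.factorial) ≤ (k + n).factorial := by
    have := Nat.le_of_dvd (Nat.factorial_pos _) (Nat.factorial_mul_factorial_dvd_factorial_add k n)
    rw [mul_comm]
    exact_mod_cast this
  rw [div_mul_div_comm, pow_add, mul_comm (x ^ k)]
  gcongr

lemma F_hasSum (x z : ℝ) (ℓ : ℕ) :
    HasSum (fun k : ℕ => (((k + (ℓ + 1) : ℕ) : ℝ) - z) *
      (x ^ (k + (ℓ + 1)) / ((k + (ℓ + 1)).factorial : ℝ)))
      (Real.exp x * (x * Q x ℓ - z * Q x (ℓ + 1))) := by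
  have := ((Q_hasSum x ℓ).mul_left x).sub ((Q_hasSum x (ℓ + 1)).mul_left z)
  convert this using 1
  · rfl
  · funext k
    have h : ((k + (ℓ + 1)).factorial : ℝ) = ((k + (ℓ + 1) : ℕ) : ℝ) * (k + ℓ).factorial := by
      rw [← add_assoc, Nat.factorial_succ]; push_cast; ring
    have h1 : ((k + (ℓ + 1) : ℕ) : ℝ) ≠ 0 := by positivity
    have h2 : ((k + ℓ).factorial : ℝ) ≠ 0 := by positivity
    rw [h]
    field_simp
    ring
  · ring

lemma eq_iff (ℓ : ℕ) (z T : ℝ) (hT : 0 < T) :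
    z = T * Q T ℓ / Q T (ℓ + 1) ↔ T * Q T ℓ - z * Q T (ℓ + 1) = 0 := by
  rw [eq_div_iff (Q_pos T hT _).ne', sub_eq_zero, eq_comm]

lemma no_two (ℓ : ℕ) (z : ℝ) (hz : (ℓ : ℝ) + 1 < z) (x y : ℝ) (hx : 0 < x) (hxy : x < y)
    (h1 : x * Q x ℓ - z * Q x (ℓ + 1) = 0) (h2 : y * Q y ℓ - z * Q y (ℓ + 1) = 0) : False := by
  have f1 := F_hasSum x z ℓ
  have f2 := F_hasSum y z ℓ
  rw [h1, mul_zero] at f1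
  rw [h2, mul_zero] at f2
  obtain ⟨t, rfl⟩ : ∃ t, y = t * x := ⟨y / x, by field_simp⟩
  have ht : 1 < t := by
    by_contra! h
    nlinarith
  have f3 := f1.mul_left (t ^ ⌈z⌉₊)
  have key : ∀ N : ℕ, t ^ ⌈z⌉₊ * (((N : ℝ) - z) * (x ^ N / (N.factorial : ℝ))) ≤
      ((N : ℝ) - z) * ((t * x) ^ N / (N.factorial : ℝ)) := by
    intro N
    have hp : 0 < x ^ N / (N.factorial : ℝ) := by positivity
    have : ((N : ℝ) - z) * t ^ ⌈z⌉₊ ≤ ((N : ℝ) - z) * t ^ N := by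
      rcases le_or_gt z N with h | h
      · exact mul_le_mul_of_nonneg_left (pow_le_pow_right₀ ht.le (Nat.ceil_le.2 h)) (by linarith)
      · exact mul_le_mul_of_nonpos_left
          (pow_le_pow_right₀ ht.le (Nat.lt_ceil.2 h).le) (by linarith)
    have := mul_le_mul_of_nonneg_right this hp.le
    rw [mul_pow, mul_div_assoc]
    linarith
  have hlt := hasSum_lt (i := 0) (fun k => key (k + (ℓ + 1))) ?_ f3 f2
  · simp at hlt
  · have hN : ((ℓ + 1 : ℕ) : ℝ) < z := by push_cast; exact hz
    simp only [zero_add]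
    generalize ℓ + 1 = N at hN
    have hp : 0 < x ^ N / (N.factorial : ℝ) := by positivity
    have := mul_lt_mul_of_neg_left (pow_lt_pow_right₀ ht (Nat.lt_ceil.2 hN)) (sub_neg.2 hN)
    have := mul_lt_mul_of_pos_right this hp
    rw [mul_pow, mul_div_assoc]
    linarith

/-- For `z > ℓ+1`, the equation `z = T·Q(T,ℓ)/Q(T,ℓ+1)` has a unique solution in `(0,∞)`. -/
theorem exists_unique_Tz (ℓ : ℕ) (hℓ : 1 ≤ ℓ) (z : ℝ) (hz : (ℓ : ℝ) + 1 < z) :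
    ∃! T : ℝ, 0 < T ∧ z = T * Q T ℓ / Q T (ℓ + 1) := by
  have hl : (0 : ℝ) < (ℓ : ℝ) + 1 := by positivity
  have hw : 1 < z / ((ℓ : ℝ) + 1) := by rwa [one_lt_div hl]
  have hz0 : 0 < z := hl.trans hz
  set a := Real.log (z / ((ℓ : ℝ) + 1)) with ha
  have ha0 : 0 < a := Real.log_pos hw
  have hea : Real.exp a = z / ((ℓ : ℝ) + 1) := Real.exp_log (by linarith)
  have haz : a ≤ z := by
    have h1 := Real.log_le_sub_one_of_pos (show 0 < z / ((ℓ : ℝ) + 1) by linarith)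
    have h2 : z / ((ℓ : ℝ) + 1) ≤ z := div_le_self hz0.le (by linarith [Nat.cast_nonneg (α := ℝ) ℓ])
    linarith
  have hc : ContinuousOn (fun x => x * Q x ℓ - z * Q x (ℓ + 1)) (Set.Icc a z) := by
    apply Continuous.continuousOn
    unfold Q
    fun_prop
  have hA : a * Q a ℓ - z * Q a (ℓ + 1) ≤ 0 := by
    have u := mul_le_mul_of_nonneg_left (Q_upper a ha0 ℓ) ha0.le
    have l := mul_le_mul_of_nonneg_left (Q_lower a ha0 (ℓ + 1)) hz0.le
    have e : a * (a ^ ℓ / (ℓ.factorial : ℝ) * Real.exp a) =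
        z * (a ^ (ℓ + 1) / ((ℓ + 1).factorial : ℝ)) := by
      rw [hea, Nat.factorial_succ]
      push_cast
      field_simp
      ring
    have : Real.exp a * (a * Q a ℓ - z * Q a (ℓ + 1)) ≤ 0 := by linarith
    exact nonpos_of_mul_nonpos_right this (Real.exp_pos a)
  have hB : 0 ≤ z * Q z ℓ - z * Q z (ℓ + 1) := by
    have : Q z ℓ - Q z (ℓ + 1) = Real.exp (-z) * (z ^ ℓ / (ℓ.factorial : ℝ)) := by
      unfold Q
      rw [Finset.sum_range_succ]; ring
    rw [← mul_sub, this]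
    positivity
  obtain ⟨T, hT, hT0⟩ := intermediate_value_Icc haz hc ⟨hA, hB⟩
  have hTp : 0 < T := ha0.trans_le hT.1
  refine ⟨T, ⟨hTp, (eq_iff ℓ z T hTp).2 hT0⟩, ?_⟩
  rintro S ⟨hS, hS1⟩
  have hS0 := (eq_iff ℓ z S hS).1 hS1
  rcases lt_trichotomy S T with h | h | h
  · exact (no_two ℓ z hz S T hS h hS0 hT0).elim
  · exact h
  · exact (no_two ℓ z hz T S hTp h hT0 hS0).elim
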